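/- As n → ∞, p̃(2,n) ~ p(2n); that is, the ratio p̃(2,n)/p(2n) tends to 1 as n → ∞. -/

import Mathlib

/-- A rectangle with integer corners: `(a, b, c, d)` represents `[a,b] × [c,d] ⊆ ℝ²`
(with `a < b`, `c < d` required in `IsTiling`). -/
abbrev Rect : Type := ℕ × ℕ × ℕ × ℕ

/-- The unit cell `[i,i+1] × [j,j+1]` lies inside the rectangle `R`. -/
def cellIn (R : Rect) (i j : ℕ) : Prop :=
  R.1 ≤ i ∧ i < R.2.1 ∧ R.2.2.1 ≤ j ∧ j < R.2.2.2

/-- `T` is a tiling of `[0,m] × [0,n]`: each rectangle has positive integer side lengths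
and lies inside `[0,m] × [0,n]`, and every unit cell of `[0,m] × [0,n]` is covered by
exactly one rectangle of `T` (equivalently, the rectangles have pairwise disjoint
interiors and their union is `[0,m] × [0,n]`). -/
def IsTiling (m n : ℕ) (T : Finset Rect) : Prop :=
  (∀ R ∈ T, R.1 < R.2.1 ∧ R.2.1 ≤ m ∧ R.2.2.1 < R.2.2.2 ∧ R.2.2.2 ≤ n) ∧
  ∀ i < m, ∀ j < n, ∃! R, R ∈ T ∧ cellIn R i j

/-- The block of a rectangle: the unordered pair of its side lengths,
recorded as a sorted pair `(min, max)`. -/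
def blockOf (R : Rect) : ℕ × ℕ :=
  (min (R.2.1 - R.1) (R.2.2.2 - R.2.2.1), max (R.2.1 - R.1) (R.2.2.2 - R.2.2.1))

/-- The block multiset of a tiling. -/
def blocksOf (T : Finset Rect) : Multiset (ℕ × ℕ) := T.val.map blockOf

/-- The number of distinct block multisets of tilings of `[0,m] × [0,n]` all of whose
blocks satisfy the predicate `allowed` (as sorted pairs of side lengths). -/
noncomputable def rectPA (m n : ℕ) (allowed : ℕ × ℕ → Prop) : ℕ :=
  Nat.card {M : Multiset (ℕ × ℕ) |
    ∃ T : Finset Rect, IsTiling m n T ∧ blocksOf T = M ∧ ∀ b ∈ M, allowed b}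

/-- The rectangular partition function `p(m,n)`: the number of distinct block multisets
of tilings of `[0,m] × [0,n]`. -/
noncomputable def rectP (m n : ℕ) : ℕ :=
  Nat.card {M : Multiset (ℕ × ℕ) | ∃ T : Finset Rect, IsTiling m n T ∧ blocksOf T = M}

/-- The Euler partition function `p(n)`. -/
def eulerP (n : ℕ) : ℕ := Fintype.card (Nat.Partition n)

/-- `p_{k,l}(2,n)`: the number of distinct block multisets of tilings of `[0,2] × [0,n]`
using only blocks with side lengths `{1,i}` for `1 ≤ i ≤ k` or `{2,j}` for `2 ≤ j ≤ l`. -/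
noncomputable def pkl (k l n : ℕ) : ℕ :=
  rectPA 2 n (fun b => (b.1 = 1 ∧ 1 ≤ b.2 ∧ b.2 ≤ k) ∨ (b.1 = 2 ∧ 2 ≤ b.2 ∧ b.2 ≤ l))

/-- `p̃(2,n)`: the number of block multisets of tilings of `[0,2] × [0,n]` using only
blocks of side lengths `{1,i}` with `i ≥ 1`. -/
noncomputable def ptilde (n : ℕ) : ℕ := rectPA 2 n (fun b => b.1 = 1)

open Filter Topology

open Finset in
theorem Finset.card_sq_le_two_mul_sum (s : Finset ℕ) (hs : ∀ x ∈ s, 0 < x) :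
    #s ^ 2 ≤ 2 * ∑ x ∈ s, x := by
  induction s using Finset.induction_on_max with
  | empty => simp
  | insert a s ha ih =>
    have hna : a ∉ s := fun h => (ha a h).false
    have hcard : #s ≤ a - 1 := by
      have : s ⊆ Ico 1 a := fun x hx => mem_Ico.2 ⟨hs x (mem_insert_of_mem hx), ha x hx⟩
      simpa using card_le_card this
    have hpos := hs a (mem_insert_self a s)
    have := ih fun x hx => hs x (mem_insert_of_mem hx)
    rw [card_insert_of_notMem hna, sum_insert hna]
    have : #s + 1 ≤ a := by omega
    nlinarith

/-- The partitions of `n`, as a finset of multisets. -/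
def partitionMultisets (n : ℕ) : Finset (Multiset ℕ) :=
  Finset.univ.image (Nat.Partition.parts (n := n))

theorem mem_partitionMultisets {n : ℕ} {s : Multiset ℕ} :
    s ∈ partitionMultisets n ↔ s.sum = n ∧ ∀ i ∈ s, 0 < i := by
  simp only [partitionMultisets, Finset.mem_image, Finset.mem_univ, true_and]
  constructor
  · rintro ⟨p, rfl⟩
    exact ⟨p.parts_sum, fun i => p.parts_pos⟩
  · rintro ⟨h, hpos⟩
    exact ⟨⟨s, fun {i} => hpos i, h⟩, rfl⟩

theorem card_partitionMultisets (n : ℕ) :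
    (partitionMultisets n).card = Fintype.card (Nat.Partition n) :=
  Finset.card_image_of_injective _ fun _ _ => Nat.Partition.ext

theorem card_toFinset_sq_le {n : ℕ} {s : Multiset ℕ} (hs : s ∈ partitionMultisets n) :
    s.toFinset.card ^ 2 ≤ 2 * n := by
  obtain ⟨hsum, hpos⟩ := mem_partitionMultisets.1 hs
  have h1 := s.toFinset.card_sq_le_two_mul_sum fun x hx => hpos x (Multiset.mem_toFinset.1 hx)
  have h2 : ∑ x ∈ s.toFinset, x ≤ s.sum := by
    rw [Finset.sum_multiset_count]
    refine Finset.sum_le_sum fun x hx => ?_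
    have := Multiset.count_pos.2 (Multiset.mem_toFinset.1 hx)
    simpa using Nat.le_mul_of_pos_left x this
  omega

/-- The partitions of `n` into parts less than `v`. -/
def partsLT (v n : ℕ) : Finset (Multiset ℕ) :=
  (partitionMultisets n).filter fun s => ∀ i ∈ s, i < v

theorem mem_partsLT {v n : ℕ} {s : Multiset ℕ} :
    s ∈ partsLT v n ↔ s.sum = n ∧ ∀ i ∈ s, 0 < i ∧ i < v := by
  rw [partsLT, Finset.mem_filter, mem_partitionMultisets, and_assoc, ← forall₂_and]

theorem card_partsLT_mono {v : ℕ} (hv : 2 ≤ v) : Monotone fun n => (partsLT v n).card := by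
  intro m n hmn
  refine Finset.card_le_card_of_injOn (· + Multiset.replicate (n - m) 1) ?_
    fun _ _ _ _ => add_right_cancel
  intro s hs
  simp only [Finset.mem_coe, mem_partsLT, Multiset.sum_add, Multiset.mem_add,
    Multiset.sum_replicate, smul_eq_mul] at hs ⊢
  refine ⟨by omega, ?_⟩
  rintro i (hi | hi)
  · exact hs.2 i hi
  · rw [Multiset.eq_of_mem_replicate hi]; omega

theorem card_partsLT_le_card_filter_mem {v n k j : ℕ} (hj : j ∈ Finset.Icc 1 k) (hk : k < v) :
    (partsLT v n).card ≤ ((partsLT v (n + k)).filter (j ∈ ·)).card := by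
  rw [Finset.mem_Icc] at hj
  refine Finset.card_le_card_of_injOn (fun s => s + (j ::ₘ Multiset.replicate (k - j) 1)) ?_
    fun _ _ _ _ => add_right_cancel
  intro s hs
  simp only [Finset.mem_coe, Finset.mem_filter, mem_partsLT, Multiset.sum_add, Multiset.mem_add,
    Multiset.sum_replicate, smul_eq_mul, Multiset.sum_cons, Multiset.mem_cons] at hs ⊢
  refine ⟨⟨by omega, ?_⟩, by simp⟩
  rintro i (hi | rfl | hi)
  · exact hs.2 i hi
  · omega
  · rw [Multiset.eq_of_mem_replicate hi]; omega

theorem sq_mul_card_partsLT_le {v n k : ℕ} (hk : k < v) :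
    (k * (partsLT v n).card) ^ 2 ≤ 2 * (n + k) * (partsLT v (n + k)).card ^ 2 := by
  have h1 : k * (partsLT v n).card ≤
      ∑ j ∈ Finset.Icc 1 k, ((partsLT v (n + k)).filter (j ∈ ·)).card := by
    have := Finset.card_nsmul_le_sum (Finset.Icc 1 k) _ _
      fun j hj => card_partsLT_le_card_filter_mem (n := n) hj hk
    simpa using this
  have h2 : ∑ j ∈ Finset.Icc 1 k, ((partsLT v (n + k)).filter (j ∈ ·)).card ≤
      ∑ _s ∈ partsLT v (n + k), Nat.sqrt (2 * (n + k)) := by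
    have := Finset.sum_card_bipartiteAbove_eq_sum_card_bipartiteBelow
      (s := Finset.Icc 1 k) (t := partsLT v (n + k)) fun j s => j ∈ s
    simp only [Finset.bipartiteAbove, Finset.bipartiteBelow] at this
    rw [this]
    refine Finset.sum_le_sum fun s hs => ?_
    have hs' := card_toFinset_sq_le (Finset.mem_filter.1 hs).1
    refine le_trans (Finset.card_le_card ?_) (Nat.le_sqrt'.2 hs')
    intro j hj
    simpa using (Finset.mem_filter.1 hj).2
  rw [Finset.sum_const, smul_eq_mul] at h2
  calc _ ≤ ((partsLT v (n + k)).card * Nat.sqrt (2 * (n + k))) ^ 2 :=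
        Nat.pow_le_pow_left (h1.trans h2) 2
    _ = Nat.sqrt (2 * (n + k)) ^ 2 * (partsLT v (n + k)).card ^ 2 := by ring
    _ ≤ _ := Nat.mul_le_mul_right _ (Nat.sqrt_le' _)

theorem mul_card_partsLT_sq_le {v n k : ℕ} (hk : k < v) (hvk : v ≤ 8 * k) (hn : n + k ≤ 2 * v) :
    v * (partsLT v n).card ^ 2 ≤ 256 * (partsLT v (n + k)).card ^ 2 := by
  have h := sq_mul_card_partsLT_le (n := n) hk
  set a := (partsLT v n).card
  set b := (partsLT v (n + k)).card
  have hv : 0 < v := by omega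
  refine Nat.le_of_mul_le_mul_left ?_ hv
  calc v * (v * a ^ 2) = v ^ 2 * a ^ 2 := by ring
    _ ≤ (8 * k) ^ 2 * a ^ 2 := by gcongr
    _ = 64 * (k * a) ^ 2 := by ring
    _ ≤ 64 * (2 * (2 * v) * b ^ 2) := by grw [h, hn]
    _ = v * (256 * b ^ 2) := by ring

theorem sq_mul_card_partsLT_le_card_add {v r : ℕ} (hr : r + 2 ≤ v) :
    v ^ 2 * (partsLT v r).card ≤ 65536 * (partsLT v (r + v)).card := by
  have hmono := card_partsLT_mono (show 2 ≤ v by omega)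
  rcases lt_or_ge v 4 with hv | hv
  · have : (partsLT v r).card ≤ (partsLT v (r + v)).card := hmono (by omega)
    have : v ^ 2 ≤ 65536 := by nlinarith
    gcongr
  · have h1 := mul_card_partsLT_sq_le (v := v) (n := r) (k := v / 4)
      (by omega) (by omega) (by omega)
    have h2 := mul_card_partsLT_sq_le (v := v) (n := r + v / 4) (k := v / 4)
      (by omega) (by omega) (by omega)
    have h3 := mul_card_partsLT_sq_le (v := v) (n := r + v / 4 + v / 4) (k := v / 4)
      (by omega) (by omega) (by omega)
    have h4 := mul_card_partsLT_sq_le (v := v) (n := r + v / 4 + v / 4 + v / 4) (k := v / 4)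
      (by omega) (by omega) (by omega)
    have h5 : (partsLT v (r + v / 4 + v / 4 + v / 4 + v / 4)).card ≤ (partsLT v (r + v)).card :=
      hmono (by omega)
    refine le_trans ?_ (Nat.mul_le_mul_left _ h5)
    rw [← Nat.pow_le_pow_iff_left (n := 2) two_ne_zero]
    calc (v ^ 2 * (partsLT v r).card) ^ 2 = v ^ 3 * (v * (partsLT v r).card ^ 2) := by ring
      _ ≤ v ^ 3 * (256 * (partsLT v (r + v / 4)).card ^ 2) := by gcongr
      _ = 256 * v ^ 2 * (v * (partsLT v (r + v / 4)).card ^ 2) := by ring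
      _ ≤ 256 * v ^ 2 * (256 * (partsLT v (r + v / 4 + v / 4)).card ^ 2) := by gcongr
      _ = 256 ^ 2 * v * (v * (partsLT v (r + v / 4 + v / 4)).card ^ 2) := by ring
      _ ≤ 256 ^ 2 * v * (256 * (partsLT v (r + v / 4 + v / 4 + v / 4)).card ^ 2) := by gcongr
      _ = 256 ^ 3 * (v * (partsLT v (r + v / 4 + v / 4 + v / 4)).card ^ 2) := by ring
      _ ≤ 256 ^ 3 * (256 * (partsLT v (r + v / 4 + v / 4 + v / 4 + v / 4)).card ^ 2) := by gcongr
      _ = _ := by ring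

/-- The partitions of `n` having a part `v` that exceeds the sum of all smaller parts by at
least `2`. -/
def gapAt (v n : ℕ) : Finset (Multiset ℕ) :=
  (partitionMultisets n).filter fun s => v ∈ s ∧ (s.filter (· < v)).sum + 2 ≤ v

/-- The partitions of `n` into parts at least `v`. -/
def partsGE (v n : ℕ) : Finset (Multiset ℕ) :=
  (partitionMultisets n).filter fun s => ∀ i ∈ s, v ≤ i

theorem Multiset.filter_lt_add_filter_ge (s : Multiset ℕ) (v : ℕ) :
    s.filter (· < v) + s.filter (v ≤ ·) = s := by
  simpa using Multiset.filter_add_not (· < v) s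

theorem card_gapAt_fiber_le (v n r : ℕ) :
    ((gapAt v n).filter fun s => (s.filter (· < v)).sum = r).card ≤
      (partsLT v r).card * (partsGE v (n - (r + v))).card := by
  rw [← Finset.card_product]
  refine Finset.card_le_card_of_injOn (fun s => (s.filter (· < v), (s.filter (v ≤ ·)).erase v))
    ?_ ?_
  · intro s hs
    simp only [gapAt, Finset.coe_filter, Finset.mem_filter, mem_partitionMultisets,
      Set.mem_ofPred_eq] at hs
    obtain ⟨⟨⟨hsum, hpos⟩, hv, -⟩, hr⟩ := hs
    have hsplit := congrArg Multiset.sum (s.filter_lt_add_filter_ge v)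
    have hmem : v ∈ s.filter (v ≤ ·) := Multiset.mem_filter.2 ⟨hv, le_rfl⟩
    have herase := Multiset.sum_erase hmem
    rw [Multiset.sum_add] at hsplit
    simp only [partsGE, Finset.coe_product, Set.mem_prod, Finset.mem_coe, mem_partsLT,
      Finset.mem_filter, mem_partitionMultisets]
    refine ⟨⟨hr, fun i hi => ?_⟩, ⟨by omega, fun i hi => ?_⟩, fun i hi => ?_⟩
    · rw [Multiset.mem_filter] at hi
      exact ⟨hpos i hi.1, hi.2⟩
    · exact hpos i (Multiset.mem_filter.1 (Multiset.mem_of_mem_erase hi)).1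
    · exact (Multiset.mem_filter.1 (Multiset.mem_of_mem_erase hi)).2
  · intro s hs t ht h
    simp only [gapAt, Finset.coe_filter, Finset.mem_filter, Set.mem_ofPred_eq] at hs ht
    simp only [Prod.mk.injEq] at h
    have hs' : v ∈ s.filter (v ≤ ·) := Multiset.mem_filter.2 ⟨hs.1.2.1, le_rfl⟩
    have ht' : v ∈ t.filter (v ≤ ·) := Multiset.mem_filter.2 ⟨ht.1.2.1, le_rfl⟩
    rw [← s.filter_lt_add_filter_ge v, ← t.filter_lt_add_filter_ge v, h.1,
      ← Multiset.cons_erase hs', ← Multiset.cons_erase ht', h.2]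

theorem card_mul_card_le_card_fiber {v n m : ℕ} (hm : m ≤ n) :
    (partsLT v m).card * (partsGE v (n - m)).card ≤
      ((partitionMultisets n).filter fun s => (s.filter (· < v)).sum = m).card := by
  rw [← Finset.card_product]
  have key : ∀ x ∈ partsLT v m ×ˢ partsGE v (n - m),
      (x.1 + x.2).filter (· < v) = x.1 ∧ (x.1 + x.2).filter (v ≤ ·) = x.2 := by
    rintro ⟨a, b⟩ h
    simp only [partsGE, Finset.mem_product, mem_partsLT, Finset.mem_filter] at h
    rw [Multiset.filter_add, Multiset.filter_add,
      Multiset.filter_eq_self.2 fun i hi => (h.1.2 i hi).2, Multiset.filter_eq_self.2 h.2.2,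
      Multiset.filter_eq_nil.2 fun i hi => not_lt.2 (h.2.2 i hi),
      Multiset.filter_eq_nil.2 fun i hi => not_le.2 (h.1.2 i hi).2]
    simp
  refine Finset.card_le_card_of_injOn (fun x => x.1 + x.2) ?_ ?_
  · intro x hx
    have hk := key x hx
    simp only [partsGE, Finset.coe_product, Set.mem_prod, Finset.mem_coe, mem_partsLT,
      Finset.mem_filter, mem_partitionMultisets] at hx ⊢
    refine ⟨⟨?_, ?_⟩, ?_⟩
    · rw [Multiset.sum_add]; omega
    · intro i hi
      rcases Multiset.mem_add.1 hi with hi | hi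
      · exact (hx.1.2 i hi).1
      · exact hx.2.1.2 i hi
    · rw [hk.1, hx.1.1]
  · intro x hx y hy h
    have hx' := key x hx
    have hy' := key y hy
    simp only at h
    rw [h] at hx'
    exact Prod.ext (hx'.1.symm.trans hy'.1) (hx'.2.symm.trans hy'.2)

theorem sq_mul_card_gapAt_le (v n : ℕ) :
    v ^ 2 * (gapAt v n).card ≤ 65536 * (partitionMultisets n).card := by
  have hfib : (gapAt v n).card = ∑ r ∈ Finset.range (v - 1),
      ((gapAt v n).filter fun s => (s.filter (· < v)).sum = r).card := by
    refine Finset.card_eq_sum_card_fiberwise fun s hs => ?_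
    have := (Finset.mem_filter.1 hs).2.2
    simp only [Finset.coe_range, Set.mem_Iio]
    omega
  rw [hfib, Finset.mul_sum]
  have hterm : ∀ r ∈ Finset.range (v - 1),
      v ^ 2 * ((gapAt v n).filter fun s => (s.filter (· < v)).sum = r).card ≤
        65536 * ((partitionMultisets n).filter fun s => (s.filter (· < v)).sum = r + v).card := by
    intro r hr
    rw [Finset.mem_range] at hr
    rcases le_or_gt (r + v) n with hn | hn
    · calc _ ≤ v ^ 2 * ((partsLT v r).card * (partsGE v (n - (r + v))).card) :=
            Nat.mul_le_mul_left _ (card_gapAt_fiber_le v n r)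
        _ = v ^ 2 * (partsLT v r).card * (partsGE v (n - (r + v))).card := by ring
        _ ≤ 65536 * (partsLT v (r + v)).card * (partsGE v (n - (r + v))).card :=
            Nat.mul_le_mul_right _ (sq_mul_card_partsLT_le_card_add (by omega))
        _ = 65536 * ((partsLT v (r + v)).card * (partsGE v (n - (r + v))).card) := by ring
        _ ≤ _ := Nat.mul_le_mul_left _ (card_mul_card_le_card_fiber hn)
    · have : ((gapAt v n).filter fun s => (s.filter (· < v)).sum = r) = ∅ := by
        refine Finset.filter_eq_empty_iff.2 fun s hs hr => ?_
        obtain ⟨hs, hv, -⟩ := Finset.mem_filter.1 hs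
        have hsplit := congrArg Multiset.sum (s.filter_lt_add_filter_ge v)
        have hmem : v ∈ s.filter (v ≤ ·) := Multiset.mem_filter.2 ⟨hv, le_rfl⟩
        have := Multiset.le_sum_of_mem hmem
        rw [Multiset.sum_add, (mem_partitionMultisets.1 hs).1] at hsplit
        omega
      simp [this]
  refine (Finset.sum_le_sum hterm).trans ?_
  rw [← Finset.mul_sum]
  refine Nat.mul_le_mul_left _ ?_
  rw [← Finset.card_biUnion]
  · exact Finset.card_le_card (Finset.biUnion_subset.2 fun r _ => Finset.filter_subset _ _)
  · intro r _ r' _ hrr'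
    refine Finset.disjoint_filter.2 fun s _ h h' => hrr' ?_
    omega

theorem exists_finset_few_distinct_parts (n K : ℕ) :
    ∃ G : Finset (Multiset ℕ), G.card ≤ (n + 1) ^ (2 * K) ∧
      ∀ s : Multiset ℕ, s.sum ≤ n → (∀ i ∈ s, 0 < i) → s.toFinset.card ≤ K → s ∈ G := by
  induction K with
  | zero =>
    refine ⟨{0}, by simp, fun s _ _ hs => ?_⟩
    simpa using hs
  | succ K ih =>
    obtain ⟨G, hG, hmem⟩ := ih
    refine ⟨((Finset.range (n + 1) ×ˢ Finset.range (n + 1)) ×ˢ G).image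
      fun x => Multiset.replicate x.1.2 x.1.1 + x.2, ?_, fun s hsum hpos hs => ?_⟩
    · refine Finset.card_image_le.trans ?_
      rw [Finset.card_product, Finset.card_product, Finset.card_range]
      calc _ ≤ (n + 1) * (n + 1) * (n + 1) ^ (2 * K) := by gcongr
        _ = _ := by ring
    rw [Finset.mem_image]
    rcases s.empty_or_exists_mem with rfl | ⟨x, hx⟩
    · exact ⟨((0, 0), 0), by simpa using hmem 0 (by simp) (by simp) (by simp), by simp⟩
    · have hsplit := Multiset.filter_add_not (· = x) s
      rw [Multiset.filter_eq'] at hsplit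
      have hsum' := congrArg Multiset.sum hsplit
      rw [Multiset.sum_add, Multiset.sum_replicate, smul_eq_mul] at hsum'
      have hcount := Multiset.count_pos.2 hx
      have hxpos := hpos x hx
      refine ⟨((x, s.count x), s.filter (¬ · = x)), ?_, hsplit⟩
      simp only [Finset.mem_product, Finset.mem_range]
      have hle := Nat.le_mul_of_pos_right (s.count x) hxpos
      refine ⟨⟨Nat.lt_succ_of_le ((Multiset.le_sum_of_mem hx).trans hsum), by omega⟩, hmem _ (by omega)
        (fun i hi => hpos i (Multiset.mem_filter.1 hi).1) ?_⟩
      have : (s.filter (¬ · = x)).toFinset = s.toFinset.erase x := by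
        ext i; simp [and_comm]
      rw [this, Finset.card_erase_of_mem (Multiset.mem_toFinset.2 hx)]
      omega

theorem mul_card_filter_count_one_le (v K n : ℕ) :
    K * ((partitionMultisets n).filter fun s => s.count 1 < v ∧ K < s.toFinset.card).card ≤
      v * (partitionMultisets n).card := by
  set A := (partitionMultisets n).filter fun s => s.count 1 < v ∧ K < s.toFinset.card with hA
  have h1 : K * A.card ≤ (A.sigma fun s => s.toFinset.erase 1).card := by
    rw [Finset.card_sigma, mul_comm, ← smul_eq_mul]
    refine Finset.card_nsmul_le_sum _ _ _ fun s hs => ?_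
    have := (Finset.mem_filter.1 hs).2.2
    have := Finset.pred_card_le_card_erase (s := s.toFinset) (a := 1)
    omega
  refine h1.trans ?_
  conv_rhs => rw [← Finset.card_range v, ← Finset.card_product]
  have hcount : ∀ x ∈ A.sigma fun s => s.toFinset.erase 1,
      (x.1.erase x.2 + Multiset.replicate x.2 1).count 1 = x.1.count 1 + x.2 := by
    rintro ⟨s, k⟩ hx
    simp only [Finset.mem_sigma, Finset.mem_erase] at hx
    simp [Multiset.count_erase_of_ne (Ne.symm hx.2.1)]
  refine Finset.card_le_card_of_injOn
    (fun x => (x.1.count 1, x.1.erase x.2 + Multiset.replicate x.2 1)) ?_ ?_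
  · rintro ⟨s, k⟩ hx
    simp only [hA, Finset.mem_coe, Finset.mem_sigma, Finset.mem_filter, mem_partitionMultisets,
      Finset.mem_erase, Multiset.mem_toFinset, Finset.mem_product, Finset.mem_range] at hx ⊢
    obtain ⟨⟨⟨hsum, hpos⟩, hc, -⟩, -, hk⟩ := hx
    have := Multiset.sum_erase hk
    refine ⟨hc, ?_, fun i hi => ?_⟩
    · rw [Multiset.sum_add, Multiset.sum_replicate, smul_eq_mul]; omega
    · rcases Multiset.mem_add.1 hi with hi | hi
      · exact hpos i (Multiset.mem_of_mem_erase hi)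
      · rw [Multiset.eq_of_mem_replicate hi]; exact one_pos
  · rintro ⟨s, k⟩ hx ⟨t, l⟩ hy h
    have hcx := hcount _ hx
    have hcy := hcount _ hy
    simp only [Prod.mk.injEq] at h hcx hcy
    have hkl : k = l := by
      rw [h.2, hcy] at hcx
      omega
    subst hkl
    have hs : k ∈ s := by
      have := (Finset.mem_sigma.1 hx).2
      simpa using Finset.mem_of_mem_erase this
    have ht : k ∈ t := by
      have := (Finset.mem_sigma.1 hy).2
      simpa using Finset.mem_of_mem_erase this
    rw [← Multiset.cons_erase hs, ← Multiset.cons_erase ht, add_right_cancel h.2]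

theorem mul_card_gapAt_le (v K n : ℕ) :
    K * (gapAt v n).card ≤ v * (partitionMultisets n).card + K * (n + 1) ^ (2 * K) := by
  obtain ⟨G, hG, hmem⟩ := exists_finset_few_distinct_parts n K
  have hsub : gapAt v n ⊆
      ((partitionMultisets n).filter fun s => s.count 1 < v ∧ K < s.toFinset.card) ∪ G := by
    intro s hs
    obtain ⟨hs, hv, hgap⟩ := Finset.mem_filter.1 hs
    obtain ⟨hsum, hpos⟩ := mem_partitionMultisets.1 hs
    rw [Finset.mem_union, Finset.mem_filter]
    rcases le_or_gt s.toFinset.card K with hK | hK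
    · exact Or.inr (hmem s hsum.le hpos hK)
    · refine Or.inl ⟨hs, ?_, hK⟩
      have h1 : Multiset.replicate (s.count 1) 1 ≤ s.filter (· < v) := by
        rw [← Multiset.le_count_iff_replicate_le, Multiset.count_filter_of_pos (by omega)]
      obtain ⟨u, hu⟩ := Multiset.le_iff_exists_add.1 h1
      have := congrArg Multiset.sum hu
      rw [Multiset.sum_add, Multiset.sum_replicate, smul_eq_mul] at this
      omega
  calc K * (gapAt v n).card
      ≤ K * (((partitionMultisets n).filter
          fun s => s.count 1 < v ∧ K < s.toFinset.card).card + G.card) :=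
        Nat.mul_le_mul_left _ ((Finset.card_le_card hsub).trans (Finset.card_union_le _ _))
    _ ≤ _ := by
        rw [mul_add]
        exact Nat.add_le_add (mul_card_filter_count_one_le v K n) (Nat.mul_le_mul_left _ hG)

theorem two_pow_le_card_partitionMultisets (n : ℕ) :
    2 ^ (Nat.sqrt n - 1) ≤ (partitionMultisets n).card := by
  set m := Nat.sqrt n with hm
  have hcard : (Finset.Icc 2 m).powerset.card = 2 ^ (m - 1) := by
    rw [Finset.card_powerset, Nat.card_Icc]; congr 1
  rw [← hcard]
  have hsum : ∀ S ∈ (Finset.Icc 2 m).powerset, S.val.sum ≤ n := by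
    intro S hS
    calc S.val.sum = ∑ x ∈ S, x := by simp
      _ ≤ S.card • m := Finset.sum_le_card_nsmul _ _ _ fun x hx =>
          (Finset.mem_Icc.1 (Finset.mem_powerset.1 hS hx)).2
      _ ≤ m * m := by
          have := Finset.card_le_card (Finset.mem_powerset.1 hS)
          rw [Nat.card_Icc] at this
          rw [smul_eq_mul]
          exact Nat.mul_le_mul_right _ (by omega)
      _ ≤ n := Nat.sqrt_le n
  refine Finset.card_le_card_of_injOn
    (fun S => S.val + Multiset.replicate (n - S.val.sum) 1) ?_ ?_
  · intro S hS
    have := hsum S hS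
    simp only [Finset.mem_coe, mem_partitionMultisets, Multiset.sum_add, Multiset.sum_replicate,
      smul_eq_mul]
    refine ⟨by omega, fun i hi => ?_⟩
    rcases Multiset.mem_add.1 hi with hi | hi
    · have := Finset.mem_Icc.1 (Finset.mem_powerset.1 hS hi); omega
    · rw [Multiset.eq_of_mem_replicate hi]; exact one_pos
  · intro S hS T hT h
    ext x
    have key : ∀ U ∈ (Finset.Icc 2 m).powerset,
        (x ∈ U ↔ 2 ≤ x ∧ x ∈ U.val + Multiset.replicate (n - U.val.sum) 1) := by
      intro U hU
      have hx : x ∈ U → 2 ≤ x ∧ x ≤ m := fun h => Finset.mem_Icc.1 (Finset.mem_powerset.1 hU h)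
      simp only [Multiset.mem_add, Finset.mem_val, Multiset.mem_replicate]
      constructor
      · exact fun h => ⟨(hx h).1, Or.inl h⟩
      · rintro ⟨h2, h | h⟩
        · exact h
        · omega
    rw [key S hS, key T hT]
    simp only at h
    rw [h]

theorem tendsto_sqrt_atTop : Tendsto Nat.sqrt atTop atTop :=
  tendsto_atTop.2 fun b => (eventually_ge_atTop (b * b)).mono fun _ h => Nat.le_sqrt.2 h

theorem tendsto_pow_div_card_partitionMultisets (c : ℕ) :
    Tendsto (fun n : ℕ => ((n : ℝ) + 1) ^ c / (partitionMultisets n).card) atTop (𝓝 0) := by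
  have h : Tendsto (fun m : ℕ => 4 * (((m + 1 : ℕ) : ℝ) ^ (2 * c) / 2 ^ (m + 1))) atTop (𝓝 0) := by
    have := ((tendsto_pow_const_div_const_pow_of_one_lt (2 * c) (one_lt_two (α := ℝ))).comp
      (tendsto_add_atTop_nat 1)).const_mul 4
    simpa using this
  refine squeeze_zero (fun n => by positivity) (fun n => ?_) (h.comp tendsto_sqrt_atTop)
  set m := Nat.sqrt n with hm
  have h1 : (n : ℝ) + 1 ≤ ((m + 1 : ℕ) : ℝ) ^ 2 := by
    have := Nat.succ_le_succ_sqrt' n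
    exact_mod_cast this
  have h2 : (2 : ℝ) ^ (m + 1) / 4 ≤ (partitionMultisets n).card := by
    have h3 : ((2 ^ (m - 1) : ℕ) : ℝ) ≤ (partitionMultisets n).card :=
      Nat.cast_le.2 (two_pow_le_card_partitionMultisets n)
    refine le_trans ?_ h3
    have : (2 : ℝ) ^ (m + 1) ≤ 2 ^ (m - 1 + 2) := pow_le_pow_right₀ one_le_two (by omega)
    rw [pow_add _ (m - 1)] at this
    push_cast
    linarith
  calc ((n : ℝ) + 1) ^ c / (partitionMultisets n).card
      ≤ (((m + 1 : ℕ) : ℝ) ^ 2) ^ c / (2 ^ (m + 1) / 4) := by gcongr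
    _ = 4 * (((m + 1 : ℕ) : ℝ) ^ (2 * c) / 2 ^ (m + 1)) := by
        rw [← pow_mul]; field_simp

theorem card_partitionMultisets_pos (n : ℕ) : 0 < (partitionMultisets n).card :=
  lt_of_lt_of_le (by positivity) (two_pow_le_card_partitionMultisets n)

theorem tendsto_card_gapAt_div (v : ℕ) :
    Tendsto (fun n => ((gapAt v n).card : ℝ) / (partitionMultisets n).card) atTop (𝓝 0) := by
  refine tendsto_order.2 ⟨fun a ha => Eventually.of_forall fun n => ha.trans_le (by positivity),
    fun ε hε => ?_⟩
  obtain ⟨K, hK⟩ := exists_nat_gt (2 * (v : ℝ) / ε)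
  have hK0 : (0 : ℝ) < K := lt_of_le_of_lt (by positivity) hK
  filter_upwards [(tendsto_pow_div_card_partitionMultisets (2 * K)).eventually
    (gt_mem_nhds (half_pos hε))] with n hn
  have hp : (0 : ℝ) < (partitionMultisets n).card := mod_cast card_partitionMultisets_pos n
  have hle : (K : ℝ) * (gapAt v n).card ≤
      v * (partitionMultisets n).card + K * ((n : ℝ) + 1) ^ (2 * K) :=
    mod_cast mul_card_gapAt_le v K n
  rw [div_lt_iff₀ hp] at hn ⊢
  rw [div_lt_iff₀ hε] at hK
  refine lt_of_mul_lt_mul_left ?_ hK0.le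
  nlinarith

theorem tendsto_sum_card_gapAt_div :
    Tendsto (fun n => ∑ v ∈ Finset.range (n + 1),
      ((gapAt v n).card : ℝ) / (partitionMultisets n).card) atTop (𝓝 0) := by
  have hsum : Summable fun v : ℕ => 65536 * (1 / (v : ℝ) ^ 2) :=
    (Real.summable_one_div_nat_pow.2 one_lt_two).mul_left _
  have h := tendsto_tsum_of_dominated_convergence (𝓕 := atTop) hsum
    tendsto_card_gapAt_div (Eventually.of_forall fun n v => ?_)
  · rw [tsum_zero] at h
    refine h.congr fun n => tsum_eq_sum fun v hv => ?_
    have : gapAt v n = ∅ := by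
      refine Finset.filter_eq_empty_iff.2 fun s hs hgap => hv ?_
      have := Multiset.le_sum_of_mem hgap.1
      rw [(mem_partitionMultisets.1 hs).1] at this
      exact Finset.mem_range.2 (by omega)
    simp [this]
  · have hp : (0 : ℝ) < (partitionMultisets n).card := mod_cast card_partitionMultisets_pos n
    have hle : (v : ℝ) ^ 2 * (gapAt v n).card ≤ 65536 * (partitionMultisets n).card :=
      mod_cast sq_mul_card_gapAt_le v n
    rw [Real.norm_of_nonneg (by positivity)]
    rcases Nat.eq_zero_or_pos v with rfl | hv
    · simp [gapAt]
    · have hv' : (0 : ℝ) < v := mod_cast hv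
      rw [div_le_iff₀ hp, mul_one_div, div_mul_eq_mul_div, le_div_iff₀ (by positivity)]
      linarith

/-- Every number up to the sum of `s` is the sum of a sub-multiset of `s`. -/
def HasAllSubsums (s : Multiset ℕ) : Prop :=
  ∀ m ≤ s.sum, ∃ t ≤ s, t.sum = m

theorem HasAllSubsums.cons {s : Multiset ℕ} (hs : HasAllSubsums s) {a : ℕ} (ha : a ≤ s.sum + 1) :
    HasAllSubsums (a ::ₘ s) := by
  intro m hm
  rw [Multiset.sum_cons] at hm
  rcases le_or_gt m s.sum with h | h
  · obtain ⟨t, ht, rfl⟩ := hs m h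
    exact ⟨t, ht.trans (Multiset.le_cons_self s a), rfl⟩
  · obtain ⟨t, ht, htm⟩ := hs (m - a) (by omega)
    exact ⟨a ::ₘ t, Multiset.cons_le_cons a ht, by rw [Multiset.sum_cons]; omega⟩

theorem HasAllSubsums.replicate_add {s : Multiset ℕ} (hs : HasAllSubsums s) {a : ℕ}
    (ha : a ≤ s.sum + 1) (k : ℕ) : HasAllSubsums (Multiset.replicate k a + s) := by
  induction k with
  | zero => simpa using hs
  | succ k ih =>
    rw [Multiset.replicate_succ, Multiset.cons_add]
    refine ih.cons ?_
    rw [Multiset.sum_add]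
    omega

theorem Multiset.filter_lt_succ (s : Multiset ℕ) (u : ℕ) :
    s.filter (· < u + 1) = Multiset.replicate (s.count u) u + s.filter (· < u) := by
  ext x
  rw [Multiset.count_add, Multiset.count_replicate, Multiset.count_filter, Multiset.count_filter]
  rcases lt_trichotomy x u with h | rfl | h
  · simp [h, h.ne', h.trans (Nat.lt_succ_self u)]
  · simp
  · simp [h.ne, h.not_gt, show ¬ x < u + 1 by omega]

theorem hasAllSubsums_of_forall_le {s : Multiset ℕ}
    (h : ∀ v ∈ s, v ≤ (s.filter (· < v)).sum + 1) : HasAllSubsums s := by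
  have key : ∀ u, HasAllSubsums (s.filter (· < u)) := by
    intro u
    induction u with
    | zero => intro m hm; exact ⟨0, by simp, by simpa [eq_comm] using hm⟩
    | succ u ih =>
      rw [Multiset.filter_lt_succ]
      by_cases hu : u ∈ s
      · exact ih.replicate_add (h u hu) _
      · simpa [Multiset.count_eq_zero_of_notMem hu] using ih
  have := key (s.sum + 1)
  rwa [Multiset.filter_eq_self.2 fun i hi => Nat.lt_succ_of_le (Multiset.le_sum_of_mem hi)] at this

/-- The column `[i, i+1] × [0, s.sum]` can be tiled by a stack of unit-width rectangles whose
heights form the multiset `s`. -/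
theorem exists_column_tiling (i : ℕ) (s : Multiset ℕ) (hs : ∀ a ∈ s, 0 < a) :
    ∃ T : Finset Rect,
      (∀ R ∈ T, R.1 = i ∧ R.2.1 = i + 1 ∧ R.2.2.1 < R.2.2.2 ∧ R.2.2.2 ≤ s.sum) ∧
      (∀ j < s.sum, ∃! R, R ∈ T ∧ cellIn R i j) ∧
      blocksOf T = s.map fun a => (1, a) := by
  induction s using Multiset.induction with
  | empty => exact ⟨∅, by simp, by simp, by simp [blocksOf]⟩
  | cons a s ih =>
    obtain ⟨T, hT, hcover, hblocks⟩ := ih fun b hb => hs b (Multiset.mem_cons_of_mem hb)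
    have ha := hs a (Multiset.mem_cons_self a s)
    have hnew : ((i, i + 1, s.sum, s.sum + a) : Rect) ∉ T := by
      intro h
      have := (hT _ h).2.2.2
      simp only at this
      omega
    refine ⟨Finset.cons _ T hnew, ?_, ?_, ?_⟩
    · intro R hR
      rw [Multiset.sum_cons]
      rcases Finset.mem_cons.1 hR with rfl | hR
      · exact ⟨rfl, rfl, by simp only; omega, by simp only; omega⟩
      · obtain ⟨h1, h2, h3, h4⟩ := hT R hR
        exact ⟨h1, h2, h3, by omega⟩
    · intro j hj
      rw [Multiset.sum_cons] at hj
      rcases lt_or_ge j s.sum with hj' | hj'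
      · obtain ⟨R, ⟨hR, hcell⟩, huniq⟩ := hcover j hj'
        refine ⟨R, ⟨Finset.mem_cons_of_mem hR, hcell⟩, ?_⟩
        rintro R' ⟨hR', hcell'⟩
        rcases Finset.mem_cons.1 hR' with rfl | hR'
        · have := hcell'.2.2.1
          simp only at this
          omega
        · exact huniq R' ⟨hR', hcell'⟩
      · refine ⟨(i, i + 1, s.sum, s.sum + a), ⟨Finset.mem_cons_self _ _, ?_⟩, ?_⟩
        · simp only [cellIn]; omega
        · rintro R' ⟨hR', hcell'⟩
          rcases Finset.mem_cons.1 hR' with rfl | hR'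
          · rfl
          · have := (hT R' hR').2.2.2
            have := hcell'.2.2.2
            omega
    · rw [blocksOf] at hblocks ⊢
      rw [Finset.cons_val, Multiset.map_cons, Multiset.map_cons, hblocks]
      congr 1
      simp only [blockOf, Prod.mk.injEq]
      omega

theorem exists_tiling_of_hasAllSubsums {n : ℕ} {s : Multiset ℕ} (hs : s ∈ partitionMultisets (2 * n))
    (hc : HasAllSubsums s) : ∃ T, IsTiling 2 n T ∧ blocksOf T = s.map fun a => (1, a) := by
  obtain ⟨hsum, hpos⟩ := mem_partitionMultisets.1 hs
  obtain ⟨t, hts, ht⟩ := hc n (by omega)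
  obtain ⟨u, rfl⟩ := Multiset.le_iff_exists_add.1 hts
  have hu : u.sum = n := by rw [Multiset.sum_add] at hsum; omega
  obtain ⟨T, hT, hTcover, hTblocks⟩ := exists_column_tiling 0 t
    fun a ha => hpos a (Multiset.mem_add.2 (Or.inl ha))
  obtain ⟨U, hU, hUcover, hUblocks⟩ := exists_column_tiling 1 u
    fun a ha => hpos a (Multiset.mem_add.2 (Or.inr ha))
  rw [ht] at hT hTcover
  rw [hu] at hU hUcover
  have hdisj : Disjoint T U := by
    refine Finset.disjoint_left.2 fun R hR hR' => ?_
    have := (hT R hR).1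
    have := (hU R hR').1
    omega
  refine ⟨T.disjUnion U hdisj, ⟨?_, ?_⟩, ?_⟩
  · intro R hR
    rcases Finset.mem_disjUnion.1 hR with hR | hR
    · obtain ⟨h1, h2, h3, h4⟩ := hT R hR
      omega
    · obtain ⟨h1, h2, h3, h4⟩ := hU R hR
      omega
  · intro i hi j hj
    obtain rfl | rfl : i = 0 ∨ i = 1 := by omega
    · obtain ⟨R, ⟨hR, hcell⟩, huniq⟩ := hTcover j hj
      refine ⟨R, ⟨Finset.mem_disjUnion.2 (Or.inl hR), hcell⟩, ?_⟩
      rintro R' ⟨hR', hcell'⟩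
      rcases Finset.mem_disjUnion.1 hR' with hR' | hR'
      · exact huniq R' ⟨hR', hcell'⟩
      · have := (hU R' hR').1
        have := hcell'.1
        omega
    · obtain ⟨R, ⟨hR, hcell⟩, huniq⟩ := hUcover j hj
      refine ⟨R, ⟨Finset.mem_disjUnion.2 (Or.inr hR), hcell⟩, ?_⟩
      rintro R' ⟨hR', hcell'⟩
      rcases Finset.mem_disjUnion.1 hR' with hR' | hR'
      · have := (hT R' hR').2.1
        have := hcell'.2.1
        omega
      · exact huniq R' ⟨hR', hcell'⟩
  · rw [blocksOf] at hTblocks hUblocks ⊢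
    rw [Multiset.map_add, ← hTblocks, ← hUblocks, ← Multiset.map_add]
    rfl

theorem IsTiling.sum_area {m n : ℕ} {T : Finset Rect} (hT : IsTiling m n T) :
    ∑ R ∈ T, (R.2.1 - R.1) * (R.2.2.2 - R.2.2.1) = m * n := by
  classical
  have h := Finset.sum_card_bipartiteAbove_eq_sum_card_bipartiteBelow
    (s := T) (t := Finset.range m ×ˢ Finset.range n) fun R x => cellIn R x.1 x.2
  have habove : ∀ R ∈ T, ((Finset.range m ×ˢ Finset.range n).bipartiteAbove
      (fun R x => cellIn R x.1 x.2) R).card = (R.2.1 - R.1) * (R.2.2.2 - R.2.2.1) := by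
    intro R hR
    rw [← Nat.card_Ico, ← Nat.card_Ico, ← Finset.card_product]
    congr 1
    have := hT.1 R hR
    ext ⟨i, j⟩
    rw [Finset.mem_bipartiteAbove]
    simp only [Finset.mem_product, Finset.mem_range, Finset.mem_Ico,
      cellIn]
    omega
  have hbelow : ∀ x ∈ Finset.range m ×ˢ Finset.range n,
      (T.bipartiteBelow (fun R x => cellIn R x.1 x.2) x).card = 1 := by
    intro x hx
    rw [Finset.mem_product, Finset.mem_range, Finset.mem_range] at hx
    obtain ⟨R, hR, huniq⟩ := hT.2 x.1 hx.1 x.2 hx.2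
    refine Finset.card_eq_one.2 ⟨R, Finset.eq_singleton_iff_unique_mem.2 ⟨?_, ?_⟩⟩
    · simpa [Finset.mem_bipartiteBelow] using hR
    · intro R' hR'
      exact huniq R' (by simpa [Finset.mem_bipartiteBelow] using hR')
  rw [Finset.sum_congr rfl habove, Finset.sum_congr rfl hbelow] at h
  simpa using h

theorem map_snd_blocksOf_mem {n : ℕ} {T : Finset Rect} (hT : IsTiling 2 n T)
    (h1 : ∀ b ∈ blocksOf T, b.1 = 1) :
    (blocksOf T).map Prod.snd ∈ partitionMultisets (2 * n) := by
  rw [mem_partitionMultisets]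
  constructor
  · rw [← hT.sum_area, blocksOf, Multiset.map_map]
    refine Finset.sum_congr rfl fun R hR => ?_
    have := h1 (blockOf R) (Multiset.mem_map_of_mem _ hR)
    rw [← min_mul_max]
    simp only [blockOf] at this
    simp [blockOf, this]
  · intro i hi
    rw [blocksOf, Multiset.map_map, Multiset.mem_map] at hi
    obtain ⟨R, hR, rfl⟩ := hi
    have := hT.1 R hR
    simp only [Function.comp, blockOf]
    omega

/-- The block multisets counted by `ptilde n`. -/
def unitBlockMultisets (n : ℕ) : Set (Multiset (ℕ × ℕ)) :=
  {M | ∃ T : Finset Rect, IsTiling 2 n T ∧ blocksOf T = M ∧ ∀ b ∈ M, b.1 = 1}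

theorem ptilde_eq_ncard (n : ℕ) : ptilde n = (unitBlockMultisets n).ncard := rfl

theorem unitBlockMultisets_subset (n : ℕ) : unitBlockMultisets n ⊆
    ((partitionMultisets (2 * n)).image fun s => s.map fun a => (1, a) :
      Finset (Multiset (ℕ × ℕ))) := by
  rintro M ⟨T, hT, rfl, h1⟩
  rw [Finset.mem_coe, Finset.mem_image]
  refine ⟨_, map_snd_blocksOf_mem hT h1, ?_⟩
  rw [Multiset.map_map]
  conv_rhs => rw [← Multiset.map_id (blocksOf T)]
  exact Multiset.map_congr rfl fun b hb => Prod.ext (h1 b hb).symm rfl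

theorem ptilde_le (n : ℕ) : ptilde n ≤ (partitionMultisets (2 * n)).card := by
  rw [ptilde_eq_ncard]
  refine (Set.ncard_le_ncard (unitBlockMultisets_subset n) (Finset.finite_toSet _)).trans ?_
  rw [Set.ncard_coe_finset]
  exact Finset.card_image_le

theorem card_le_ptilde_add (n : ℕ) : (partitionMultisets (2 * n)).card ≤
    ptilde n + ∑ v ∈ Finset.range (2 * n + 1), (gapAt v (2 * n)).card := by
  set B := (Finset.range (2 * n + 1)).biUnion fun v => gapAt v (2 * n) with hB
  have hgood : (partitionMultisets (2 * n) \ B).card ≤ ptilde n := by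
    rw [ptilde_eq_ncard, ← Finset.card_image_of_injective _
      (Multiset.map_injective (Prod.mk_right_injective (1 : ℕ))), ← Set.ncard_coe_finset]
    refine Set.ncard_le_ncard ?_
      ((Finset.finite_toSet _).subset (unitBlockMultisets_subset n))
    intro M hM
    obtain ⟨s, hs, rfl⟩ := Finset.mem_image.1 (Finset.mem_coe.1 hM)
    obtain ⟨hs, hsB⟩ := Finset.mem_sdiff.1 hs
    obtain ⟨T, hT, hblocks⟩ := exists_tiling_of_hasAllSubsums hs <| hasAllSubsums_of_forall_le <| by
      intro v hv
      by_contra! hlt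
      refine hsB (Finset.mem_biUnion.2 ⟨v, ?_, Finset.mem_filter.2 ⟨hs, hv, hlt⟩⟩)
      have := Multiset.le_sum_of_mem hv
      rw [(mem_partitionMultisets.1 hs).1] at this
      exact Finset.mem_range.2 (by omega)
    refine ⟨T, hT, hblocks, fun b hb => ?_⟩
    obtain ⟨a, -, rfl⟩ := Multiset.mem_map.1 hb
    rfl
  have hbad : B.card ≤ ∑ v ∈ Finset.range (2 * n + 1), (gapAt v (2 * n)).card :=
    Finset.card_biUnion_le
  have := Finset.card_le_card_sdiff_add_card (s := partitionMultisets (2 * n)) (t := B)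
  omega

/-- As `n → ∞`, `p̃(2,n) ~ p(2n)`. -/
theorem ptilde_asymptotic :
    Filter.Tendsto (fun n : ℕ => (ptilde n : ℝ) / (eulerP (2 * n) : ℝ))
      Filter.atTop (nhds 1) := by
  simp only [eulerP, ← card_partitionMultisets]
  have hdouble : Tendsto (fun n : ℕ => 2 * n) atTop atTop :=
    tendsto_id.const_mul_atTop' two_pos
  have hlower := (tendsto_sum_card_gapAt_div.comp hdouble).const_sub 1
  rw [sub_zero] at hlower
  refine tendsto_of_tendsto_of_tendsto_of_le_of_le hlower tendsto_const_nhds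
    (fun n => ?_) (fun n => ?_)
  · have hp : (0 : ℝ) < (partitionMultisets (2 * n)).card :=
      mod_cast card_partitionMultisets_pos (2 * n)
    have hle : ((partitionMultisets (2 * n)).card : ℝ) ≤
        ptilde n + ∑ v ∈ Finset.range (2 * n + 1), ((gapAt v (2 * n)).card : ℝ) :=
      mod_cast card_le_ptilde_add n
    simp only [Function.comp]
    rw [← Finset.sum_div, sub_le_iff_le_add, ← add_div, le_div_iff₀ hp, one_mul]
    exact hle
  · exact div_le_one_of_le₀ (Nat.cast_le.2 (ptilde_le n)) (Nat.cast_nonneg _)
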